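/- Let G be a Θ1-graph of order n with branch vertices x and y joined by four internally disjoint paths, and let e = uv be an edge of G. If both x and y belong to N_u(e), then |n_u(e) − n_v(e)| = n − g, where g is the length of a shortest cycle of G containing the edge e. -/

import Mathlib

attribute [local instance] Classical.propDecidable

noncomputable def nC {V : Type*} [Fintype V] (G : SimpleGraph V) (u v : V) : ℕ :=
  (Finset.univ.filter fun w => G.dist u w < G.dist v w).card

/-- Two paths are internally disjoint if every common vertex is an endpoint of both. -/
def IntDisj {V : Type*} {G : SimpleGraph V} {x y x' y' : V}
    (P : G.Walk x y) (Q : G.Walk x' y') : Prop :=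
  ∀ v : V, v ∈ P.support → v ∈ Q.support → (v = x ∨ v = y) ∧ (v = x' ∨ v = y')
/-- `G` consists of the two distinct vertices `x, y` joined by the four pairwise
internally disjoint paths `P₁, P₂, P₃, P₄`, every vertex and every edge of `G`
lying on one of these paths. -/
def Theta1Cond {V : Type*} (G : SimpleGraph V) (x y : V)
    (P₁ P₂ P₃ P₄ : G.Walk x y) : Prop :=
  x ≠ y ∧
  P₁.IsPath ∧ P₂.IsPath ∧ P₃.IsPath ∧ P₄.IsPath ∧
  1 ≤ P₁.length ∧ 1 ≤ P₂.length ∧ 1 ≤ P₃.length ∧ 1 ≤ P₄.length ∧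
  P₁ ≠ P₂ ∧ P₁ ≠ P₃ ∧ P₁ ≠ P₄ ∧ P₂ ≠ P₃ ∧ P₂ ≠ P₄ ∧ P₃ ≠ P₄ ∧
  IntDisj P₁ P₂ ∧ IntDisj P₁ P₃ ∧ IntDisj P₁ P₄ ∧
  IntDisj P₂ P₃ ∧ IntDisj P₂ P₄ ∧ IntDisj P₃ P₄ ∧
  (∀ v : V, v ∈ P₁.support ∨ v ∈ P₂.support ∨ v ∈ P₃.support ∨ v ∈ P₄.support) ∧
  (∀ e ∈ G.edgeSet, e ∈ P₁.edges ∨ e ∈ P₂.edges ∨ e ∈ P₃.edges ∨ e ∈ P₄.edges)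

/-- `G` is a Θ₁-graph. -/
def IsTheta1 {V : Type*} (G : SimpleGraph V) : Prop :=
  ∃ (x y : V) (P₁ P₂ P₃ P₄ : G.Walk x y), Theta1Cond G x y P₁ P₂ P₃ P₄

namespace SimpleGraph

variable {V : Type*} {G : SimpleGraph V}

/-- A geodesic from `u` to a vertex that is not closer to `v` avoids the edge `uv`. -/
theorem Connected.dist_deleteEdges_le (hG : G.Connected) {u v w : V} (huv : u ≠ v)
    (h : G.dist u w ≤ G.dist v w) :
    (G.deleteEdges {s(u, v)}).dist u w ≤ G.dist u w := by
  obtain ⟨p, hp⟩ := hG.exists_walk_length_eq_dist u w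
  have hv : s(u, v) ∉ p.edges := by
    intro he
    have hv := p.snd_mem_support_of_mem_edges he
    have hlen := congrArg Walk.length (p.take_spec hv)
    rw [Walk.length_append] at hlen
    have h0 : (p.takeUntil v hv).length ≠ 0 := fun h0 => huv (Walk.eq_of_length_eq_zero h0)
    have := G.dist_le (p.dropUntil v hv)
    omega
  rw [← hp, ← Walk.length_transfer p (H := G.deleteEdges {s(u, v)})
    (fun e he => by
      rw [edgeSet_deleteEdges]
      exact ⟨p.edges_subset_edgeSet he, fun h' => hv (h' ▸ he)⟩)]
  exact dist_le _

/-- Deleting a non-bridge edge `uv` does not change which of `u`, `v` is closer to a vertex. -/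
theorem Connected.dist_lt_dist_iff_deleteEdges (hG : G.Connected) {u v : V} (huv : u ≠ v)
    (hH : (G.deleteEdges {s(u, v)}).Connected) (w : V) :
    G.dist u w < G.dist v w ↔
      (G.deleteEdges {s(u, v)}).dist u w < (G.deleteEdges {s(u, v)}).dist v w := by
  have hu := Reachable.dist_anti (G.deleteEdges_le {s(u, v)}) (hH u w)
  have hv := Reachable.dist_anti (G.deleteEdges_le {s(u, v)}) (hH v w)
  have h1 : G.dist u w ≤ G.dist v w → _ := hG.dist_deleteEdges_le huv
  have h2 : G.dist v w ≤ G.dist u w → _ := hG.dist_deleteEdges_le huv.symm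
  rw [Sym2.eq_swap] at h2
  constructor
  · intro h
    have := h1 h.le
    omega
  · intro h
    by_contra hc
    have := h2 (not_lt.mp hc)
    omega

/-- Along a geodesic, the distances to the two ends are given by the index. -/
theorem Connected.dist_getVert_of_length_eq_dist (hG : G.Connected) {u v : V} (p : G.Walk u v)
    (hp : p.length = G.dist u v) {i : ℕ} (hi : i ≤ p.length) :
    G.dist u (p.getVert i) = i ∧ G.dist v (p.getVert i) = p.length - i := by
  have h1 := G.dist_le (p.take i)
  have h2 := G.dist_le (p.drop i)
  have h3 : G.dist u v ≤ _ := hG.dist_triangle (v := p.getVert i)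
  rw [Walk.take_length] at h1
  rw [Walk.drop_length] at h2
  rw [dist_comm (u := v)]
  omega

/-- The length of a shortest cycle through `uv` is one more than the distance between `u` and `v`
after deletion of that edge. -/
theorem shortest_cycle_length_eq {u v : V} (he : G.Adj u v) {g : ℕ}
    (hg : ∃ (r : V) (c : G.Walk r r), c.IsCycle ∧ s(u, v) ∈ c.edges ∧ c.length = g)
    (hgmin : ∀ (r : V) (c : G.Walk r r), c.IsCycle → s(u, v) ∈ c.edges → g ≤ c.length) :
    g = (G.deleteEdges {s(u, v)}).dist u v + 1 := by
  obtain ⟨r, c, hc, hec, rfl⟩ := hg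
  have hreach : (G.deleteEdges {s(u, v)}).Reachable u v :=
    (adj_and_reachable_delete_edges_iff_exists_cycle.mpr ⟨r, c, hc, hec⟩).2
  apply le_antisymm
  · obtain ⟨p, hp, hpl⟩ := hreach.exists_path_of_dist
    have hp' := hp.mapLe (G.deleteEdges_le {s(u, v)})
    have hne : s(v, u) ∉ (p.mapLe (G.deleteEdges_le {s(u, v)})).edges := by
      rw [Walk.edges_mapLe_eq_edges]
      intro h
      have := p.edges_subset_edgeSet h
      simp at this
    have := hgmin v _ ((Walk.cons_isCycle_iff _ he.symm).mpr ⟨hp', hne⟩)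
      (by simp [Sym2.eq_swap])
    simpa [hpl] using this
  · have hu := c.fst_mem_support_of_mem_edges hec
    have hc' := hc.rotate hu
    have hec' : s(u, v) ∈ (c.rotate u hu).edges := (c.rotate_edges u hu).mem_iff.mpr hec
    rw [← c.length_rotate u hu]
    generalize c.rotate u hu = c' at hc' hec'
    have hv := c'.snd_mem_support_of_mem_edges hec'
    have hspec := c'.take_spec hv
    have hlen := congrArg Walk.length hspec
    have hnd := hc'.isTrail.edges_nodup
    rw [← hspec, Walk.edges_append, List.nodup_append] at hnd
    rw [Walk.length_append] at hlen
    have key : ∀ {a b : V} (q : G.Walk a b), s(u, v) ∉ q.edges →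
        (G.deleteEdges {s(u, v)}).dist a b ≤ q.length := by
      intro a b q hq
      rw [← Walk.length_transfer q (H := G.deleteEdges {s(u, v)})
        (fun e he => by
          rw [edgeSet_deleteEdges]
          exact ⟨q.edges_subset_edgeSet he, fun h' => hq (h' ▸ he)⟩)]
      exact dist_le _
    have h0 : (c'.takeUntil v hv).length ≠ 0 := fun h0 => he.ne (Walk.eq_of_length_eq_zero h0)
    have h1 : (c'.dropUntil v hv).length ≠ 0 := fun h0 => he.ne' (Walk.eq_of_length_eq_zero h0)
    by_cases h : s(u, v) ∈ (c'.takeUntil v hv).edges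
    · have := key (c'.dropUntil v hv) (fun h' => hnd.2.2 _ h _ h' rfl)
      rw [dist_comm] at this
      omega
    · have := key _ h
      omega

/-- Every internal vertex of `P` has no neighbours besides its two neighbours on `P`. -/
def Walk.IsBare {x y : V} (P : G.Walk x y) : Prop :=
  ∀ i, 0 < i → i < P.length → ∀ z, G.Adj (P.getVert i) z →
    z = P.getVert (i - 1) ∨ z = P.getVert (i + 1)

theorem Walk.IsBare.reverse {x y : V} {P : G.Walk x y} (h : P.IsBare) : P.reverse.IsBare := by
  intro i hi hil z hz
  rw [Walk.length_reverse] at hil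
  rw [Walk.getVert_reverse] at hz
  have := h (P.length - i) (by omega) (by omega) z hz
  rw [Walk.getVert_reverse, Walk.getVert_reverse,
    show P.length - (i - 1) = P.length - i + 1 by omega,
    show P.length - (i + 1) = P.length - i - 1 by omega]
  exact this.symm

/-- A walk between the ends of the edge `uv` of a bare path that avoids this edge contains all
internal vertices of the path. -/
theorem Walk.IsBare.getVert_mem_support {x y : V} {P : G.Walk x y} (hP : P.IsPath)
    (hB : P.IsBare) {k : ℕ} (hk : k + 1 < P.length)
    (D : (G.deleteEdges {s(P.getVert k, P.getVert (k + 1))}).Walk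
      (P.getVert k) (P.getVert (k + 1)))
    {j : ℕ} (hj0 : 0 < j) (hj : j < P.length) : P.getVert j ∈ D.support := by
  have inj : ∀ {a b : ℕ}, a ≤ P.length → b ≤ P.length → P.getVert a = P.getVert b → a = b :=
    fun ha hb h => hP.getVert_injOn ha hb h
  by_contra hw
  have hjk : j ≠ k := by rintro rfl; exact hw D.start_mem_support
  have hjk' : j ≠ k + 1 := by rintro rfl; exact hw D.end_mem_support
  rcases Nat.lt_or_ge k j with hkj | hkj
  · obtain ⟨d, hd, ⟨i, hi, hid⟩, hd2⟩ := D.reverse.exists_boundary_dart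
      {w | ∃ i, (k < i ∧ i < j) ∧ P.getVert i = w} ⟨k + 1, by omega, rfl⟩
      (by rintro ⟨i, hi, h⟩; have := inj (by omega) (by omega) h; omega)
    have hadj := d.adj
    rw [deleteEdges_adj, ← hid] at hadj
    rcases hB i (by omega) (by omega) _ hadj.1 with h | h
    · by_cases hik : i = k + 1
      · subst hik
        apply hadj.2
        rw [h]
        exact Sym2.eq_swap
      · exact hd2 ⟨i - 1, by omega, h.symm⟩
    · by_cases hik : i + 1 = j
      · have := D.reverse.dart_snd_mem_support_of_mem_darts hd
        rw [h, hik] at this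
        exact hw (by simpa using this)
      · exact hd2 ⟨i + 1, by omega, h.symm⟩
  · obtain ⟨d, hd, ⟨i, hi, hid⟩, hd2⟩ := D.exists_boundary_dart
      {w | ∃ i, (j < i ∧ i ≤ k) ∧ P.getVert i = w} ⟨k, by omega, rfl⟩
      (by rintro ⟨i, hi, h⟩; have := inj (by omega) (by omega) h; omega)
    have hadj := d.adj
    rw [deleteEdges_adj, ← hid] at hadj
    rcases hB i (by omega) (by omega) _ hadj.1 with h | h
    · by_cases hik : i = j + 1
      · subst hik
        have := D.dart_snd_mem_support_of_mem_darts hd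
        rw [h] at this
        exact hw this
      · exact hd2 ⟨i - 1, by omega, h.symm⟩
    · by_cases hik : i = k
      · subst hik
        apply hadj.2
        rw [h]
        rfl
      · exact hd2 ⟨i + 1, by omega, h.symm⟩

/-- If both ends of a bare path are closer to `u` than to its internal vertex `v`, then so is every
vertex that is not internal to the path. -/
theorem Walk.IsBare.dist_lt_dist {x y : V} {P : G.Walk x y} (hB : P.IsBare)
    (hG : G.Connected) {u v w : V} (hx : G.dist u x < G.dist v x) (hy : G.dist u y < G.dist v y)
    (hv : ∃ i, (0 < i ∧ i < P.length) ∧ P.getVert i = v)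
    (hw : ¬ ∃ i, (0 < i ∧ i < P.length) ∧ P.getVert i = w) :
    G.dist u w < G.dist v w := by
  obtain ⟨p, hp⟩ := hG.exists_walk_length_eq_dist v w
  obtain ⟨d, hd, ⟨i, hi, hid⟩, hd2⟩ := p.exists_boundary_dart
    {w | ∃ i, (0 < i ∧ i < P.length) ∧ P.getVert i = w} hv hw
  have hs := p.dart_snd_mem_support_of_mem_darts hd
  have hadj := d.adj
  rw [← hid] at hadj
  have hxy : d.snd = x ∨ d.snd = y := by
    rcases hB i hi.1 hi.2 _ hadj with h | h
    · by_cases h1 : i = 1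
      · subst h1
        left
        simpa using h
      · exact (hd2 ⟨i - 1, by omega, h.symm⟩).elim
    · by_cases h1 : i + 1 = P.length
      · right
        rw [h, h1, P.getVert_length]
      · exact (hd2 ⟨i + 1, by omega, h.symm⟩).elim
  have hlt : G.dist u d.snd < G.dist v d.snd := by
    rcases hxy with h | h <;> rw [h] <;> assumption
  have hlen := congrArg Walk.length (p.take_spec hs)
  rw [Walk.length_append] at hlen
  have h1 := G.dist_le (p.takeUntil _ hs)
  have h2 := G.dist_le (p.dropUntil _ hs)
  have h3 : G.dist u w ≤ _ := hG.dist_triangle (v := d.snd)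
  omega

theorem sum_range_sign_eq_zero (L : ℕ) :
    ∑ i ∈ Finset.range (L + 1),
      ((if i < L - i then (1 : ℤ) else 0) - (if L - i < i then 1 else 0)) = 0 := by
  have h := Finset.sum_range_reflect
    (fun i => ((if i < L - i then (1 : ℤ) else 0) - (if L - i < i then 1 else 0))) (L + 1)
  have h2 : ∀ i ∈ Finset.range (L + 1),
      ((if L + 1 - 1 - i < L - (L + 1 - 1 - i) then (1 : ℤ) else 0)
        - (if L - (L + 1 - 1 - i) < L + 1 - 1 - i then 1 else 0))
      = -((if i < L - i then (1 : ℤ) else 0) - (if L - i < i then 1 else 0)) := by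
    intro i hi
    rw [Finset.mem_range] at hi
    rw [show L + 1 - 1 - i = L - i by omega, show L - (L - i) = i by omega]
    ring
  rw [Finset.sum_congr rfl h2, Finset.sum_neg_distrib] at h
  omega

/-- If every vertex off a geodesic of `G - uv` joining `u` and `v` is closer to `u` than to `v`, then
the counts of vertices closer to either end differ by the number of these vertices. -/
theorem nC_sub_nC_of_forall_notMem_support [Fintype V] (hG : G.Connected) {u v : V}
    (huv : u ≠ v) (hH : (G.deleteEdges {s(u, v)}).Connected)
    (D : (G.deleteEdges {s(u, v)}).Walk u v)
    (hD : D.length = (G.deleteEdges {s(u, v)}).dist u v)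
    (hout : ∀ w ∉ D.support, G.dist u w < G.dist v w) :
    |(nC G u v : ℤ) - (nC G v u : ℤ)| = (Fintype.card V : ℤ) - ((D.length + 1 : ℕ) : ℤ) := by
  have hpath := D.isPath_of_length_eq_dist hD
  let f : V → ℤ := fun w => (if G.dist u w < G.dist v w then (1 : ℤ) else 0)
    - (if G.dist v w < G.dist u w then 1 else 0)
  have hsum : (nC G u v : ℤ) - (nC G v u : ℤ) = ∑ w, f w := by
    simp only [nC, f, Finset.sum_sub_distrib, Finset.sum_boole]
  have hswap := hG.dist_lt_dist_iff_deleteEdges huv.symm (by rwa [Sym2.eq_swap])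
  rw [Sym2.eq_swap] at hswap
  have hsupp : D.support.toFinset = (Finset.range (D.length + 1)).image D.getVert := by
    ext w
    simp [Walk.mem_support_iff_exists_getVert, and_comm]
  have hin : ∑ w ∈ D.support.toFinset, f w = 0 := by
    rw [hsupp, Finset.sum_image, ← sum_range_sign_eq_zero D.length]
    · refine Finset.sum_congr rfl fun i hi => ?_
      have hi' : i ≤ D.length := by simpa [Nat.lt_succ_iff] using hi
      obtain ⟨h1, h2⟩ := hH.dist_getVert_of_length_eq_dist D hD hi'
      have h3 := hG.dist_lt_dist_iff_deleteEdges huv hH (D.getVert i)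
      have h4 := hswap (D.getVert i)
      rw [h1, h2] at h3 h4
      simp only [f, h3, h4]
    · intro a ha b hb h
      simp only [Finset.coe_range, Set.mem_Iio] at ha hb
      exact hpath.getVert_injOn (Nat.lt_succ_iff.mp ha) (Nat.lt_succ_iff.mp hb) h
  have hcard : D.support.toFinset.card = D.length + 1 := by
    rw [List.toFinset_card_of_nodup hpath.support_nodup, Walk.length_support]
  have hcompl : ∑ w ∈ (D.support.toFinset)ᶜ, f w = ((D.support.toFinset)ᶜ.card : ℤ) := by
    rw [Finset.card_eq_sum_ones, Nat.cast_sum]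
    refine Finset.sum_congr rfl fun w hw => ?_
    have h := hout w (by simpa using hw)
    simp [f, h, h.le]
  have hle := Finset.card_le_univ D.support.toFinset
  rw [Finset.card_compl, hcard] at hcompl
  rw [hcard] at hle
  rw [hsum, ← Finset.sum_add_sum_compl D.support.toFinset f, hin, hcompl, zero_add,
    Nat.cast_sub hle]
  exact abs_of_nonneg (by rw [sub_nonneg]; exact_mod_cast hle)

/-- The conclusion for an edge `uv` of a bare path traversed from `u` to `v`. -/
theorem Walk.IsBare.abs_nC_sub_nC [Fintype V] {x y : V} {P : G.Walk x y} (hP : P.IsPath)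
    (hB : P.IsBare) (hG : G.Connected) {u v : V} (he : G.Adj u v)
    (hx : G.dist u x < G.dist v x) (hy : G.dist u y < G.dist v y) {g : ℕ}
    (hg : ∃ (r : V) (c : G.Walk r r), c.IsCycle ∧ s(u, v) ∈ c.edges ∧ c.length = g)
    (hgmin : ∀ (r : V) (c : G.Walk r r), c.IsCycle → s(u, v) ∈ c.edges → g ≤ c.length)
    {k : ℕ} (hk : k < P.length) (hu : P.getVert k = u) (hv : P.getVert (k + 1) = v) :
    |(nC G u v : ℤ) - (nC G v u : ℤ)| = (Fintype.card V : ℤ) - (g : ℤ) := by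
  have hk' : k + 1 < P.length := by
    by_contra hc
    rw [show k + 1 = P.length by omega, P.getVert_length] at hv
    subst hv
    simp at hy
  have hH : (G.deleteEdges {s(u, v)}).Connected := by
    obtain ⟨r, c, hc, hec, -⟩ := hg
    apply hG.connected_delete_edge_of_not_isBridge
    rw [isBridge_iff, not_not]
    exact (adj_and_reachable_delete_edges_iff_exists_cycle.mpr ⟨r, c, hc, hec⟩).2
  obtain ⟨D, hD⟩ := hH.exists_walk_length_eq_dist u v
  rw [shortest_cycle_length_eq he hg hgmin, ← hD]
  refine nC_sub_nC_of_forall_notMem_support hG he.ne hH D hD fun w hw => ?_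
  refine hB.dist_lt_dist hG hx hy ⟨k + 1, by omega, hv⟩ ?_
  rintro ⟨j, hj, rfl⟩
  subst hu hv
  exact hw (hB.getVert_mem_support hP hk' D hj.1 hj.2)

/-- A path is bare if each edge of the graph that is not on it lies on some walk meeting it only in
its ends. -/
theorem Walk.isBare_of_forall_edge {x y : V} {P : G.Walk x y} (hP : P.IsPath)
    (h : ∀ e ∈ G.edgeSet, e ∈ P.edges ∨ ∃ Q : G.Walk x y, IntDisj P Q ∧ e ∈ Q.edges) :
    P.IsBare := by
  intro i hi hil z hz
  rcases h _ ((G.mem_edgeSet).mpr hz) with h | ⟨Q, hQ, h⟩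
  · obtain ⟨t, ht, hst⟩ := P.mk_mem_edges_iff_exists.mp h
    rcases Sym2.eq_iff.mp hst with ⟨h1, h2⟩ | ⟨h1, h2⟩
    · have := hP.getVert_injOn (show t ≤ _ by omega) (show i ≤ _ by omega) h1
      subst this
      exact .inr h2.symm
    · have := hP.getVert_injOn (show t + 1 ≤ _ by omega) (show i ≤ _ by omega) h2
      subst this
      exact .inl h1.symm
  · rcases (hQ _ (P.getVert_mem_support i) (Q.fst_mem_support_of_mem_edges h)).1 with h | h
    · have := hP.getVert_injOn (show i ≤ _ by omega) (show 0 ≤ _ by omega)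
        (h.trans P.getVert_zero.symm)
      omega
    · have := hP.getVert_injOn (show i ≤ _ by omega) (show P.length ≤ _ from le_rfl)
        (h.trans P.getVert_length.symm)
      omega

/-- The conclusion for an edge of a bare path. -/
theorem Walk.IsBare.abs_nC_sub_nC_of_mem_edges [Fintype V] {x y : V} {P : G.Walk x y}
    (hP : P.IsPath) (hB : P.IsBare) (hG : G.Connected) {u v : V} (he : G.Adj u v)
    (hx : G.dist u x < G.dist v x) (hy : G.dist u y < G.dist v y) {g : ℕ}
    (hg : ∃ (r : V) (c : G.Walk r r), c.IsCycle ∧ s(u, v) ∈ c.edges ∧ c.length = g)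
    (hgmin : ∀ (r : V) (c : G.Walk r r), c.IsCycle → s(u, v) ∈ c.edges → g ≤ c.length)
    (heP : s(u, v) ∈ P.edges) :
    |(nC G u v : ℤ) - (nC G v u : ℤ)| = (Fintype.card V : ℤ) - (g : ℤ) := by
  obtain ⟨t, ht, hst⟩ := P.mk_mem_edges_iff_exists.mp heP
  rcases Sym2.eq_iff.mp hst with ⟨h1, h2⟩ | ⟨h1, h2⟩
  · exact hB.abs_nC_sub_nC hP hG he hx hy hg hgmin ht h1 h2
  · refine hB.reverse.abs_nC_sub_nC hP.reverse hG he hy hx hg hgmin (k := P.length - (t + 1))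
      (by rw [Walk.length_reverse]; omega) ?_ ?_
    · rw [Walk.getVert_reverse, ← h2]
      congr 1
      omega
    · rw [Walk.getVert_reverse, ← h1]
      congr 1
      omega

end SimpleGraph

theorem IntDisj.symm {V : Type*} {G : SimpleGraph V} {x y x' y' : V}
    {P : G.Walk x y} {Q : G.Walk x' y'} (h : IntDisj P Q) : IntDisj Q P :=
  fun v hQ hP => (h v hP hQ).symm

theorem Theta1Cond.connected {V : Type*} {G : SimpleGraph V} {x y : V}
    {P₁ P₂ P₃ P₄ : G.Walk x y} (h : Theta1Cond G x y P₁ P₂ P₃ P₄) : G.Connected := by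
  obtain ⟨-, -, -, -, -, -, -, -, -, -, -, -, -, -, -, -, -, -, -, -, -, hV, -⟩ := h
  refine G.connected_iff_exists_forall_reachable.mpr ⟨x, fun w => ?_⟩
  rcases hV w with h | h | h | h <;> exact ⟨SimpleGraph.Walk.takeUntil _ _ h⟩

/-- In a Θ₁-graph of order `n` with branch vertices `x, y`, if both `x` and `y` lie
in `N_u(e)` for an edge `e = uv`, then `|n_u(e) − n_v(e)| = n − g`, where `g` is the
length of a shortest cycle of `G` containing `e`. -/
theorem theta1_diff_of_same_side {V : Type*} [Fintype V] {G : SimpleGraph V}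
    {x y : V} {P₁ P₂ P₃ P₄ : G.Walk x y} (hΘ : Theta1Cond G x y P₁ P₂ P₃ P₄)
    (u v : V) (he : G.Adj u v)
    (hx : G.dist u x < G.dist v x) (hy : G.dist u y < G.dist v y) (g : ℕ)
    (hg : ∃ (r : V) (c : G.Walk r r), c.IsCycle ∧ s(u, v) ∈ c.edges ∧ c.length = g)
    (hgmin : ∀ (r : V) (c : G.Walk r r), c.IsCycle → s(u, v) ∈ c.edges →
      g ≤ c.length) :
    |(nC G u v : ℤ) - (nC G v u : ℤ)| = (Fintype.card V : ℤ) - (g : ℤ) := by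
  have hG := hΘ.connected
  obtain ⟨-, p₁, p₂, p₃, p₄, -, -, -, -, -, -, -, -, -, -, d₁₂, d₁₃, d₁₄, d₂₃, d₂₄, d₃₄, -, hE⟩ := hΘ
  rcases hE s(u, v) he with h | h | h | h
  · refine (SimpleGraph.Walk.isBare_of_forall_edge p₁ fun e he => ?_).abs_nC_sub_nC_of_mem_edges
      p₁ hG he hx hy hg hgmin h
    rcases hE e he with h | h | h | h
    exacts [.inl h, .inr ⟨P₂, d₁₂, h⟩, .inr ⟨P₃, d₁₃, h⟩, .inr ⟨P₄, d₁₄, h⟩]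
  · refine (SimpleGraph.Walk.isBare_of_forall_edge p₂ fun e he => ?_).abs_nC_sub_nC_of_mem_edges
      p₂ hG he hx hy hg hgmin h
    rcases hE e he with h | h | h | h
    exacts [.inr ⟨P₁, d₁₂.symm, h⟩, .inl h, .inr ⟨P₃, d₂₃, h⟩, .inr ⟨P₄, d₂₄, h⟩]
  · refine (SimpleGraph.Walk.isBare_of_forall_edge p₃ fun e he => ?_).abs_nC_sub_nC_of_mem_edges
      p₃ hG he hx hy hg hgmin h
    rcases hE e he with h | h | h | h
    exacts [.inr ⟨P₁, d₁₃.symm, h⟩, .inr ⟨P₂, d₂₃.symm, h⟩, .inl h, .inr ⟨P₄, d₃₄, h⟩]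
  · refine (SimpleGraph.Walk.isBare_of_forall_edge p₄ fun e he => ?_).abs_nC_sub_nC_of_mem_edges
      p₄ hG he hx hy hg hgmin h
    rcases hE e he with h | h | h | h
    exacts [.inr ⟨P₁, d₁₄.symm, h⟩, .inr ⟨P₂, d₂₄.symm, h⟩, .inr ⟨P₃, d₃₄.symm, h⟩, .inl h]
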